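/- Let n ∈ ℕ and T_0 = π/(2n+1). Then T_opt(t) → +∞ as t → T_0 with t < T_0, and T_opt(t) → +∞ as t → T_0 with t > T_0 (the one-sided limits being taken through points of (0,2π) \ { π/(2m+1) : m ∈ ℕ }, where T_opt is defined). -/

import Mathlib

open MeasureTheory Set Real Filter Topology

noncomputable section

instance : Fact (0 < 2 * Real.pi) := ⟨by positivity⟩

/-- λ_k: 0 for even k, π for odd k. -/
def lam (k : ℕ) : ℝ := if Even k then 0 else Real.pi

/-- Covered set D(T₀, t) ⊆ ℝ/(2πℤ): the union over k of the projections of the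
observation intervals (k·T₀, min((k+1)·T₀, t)) translated by −λ_k. -/
def coveredSet (T0 t : ℝ) : Set (AddCircle (2 * Real.pi)) :=
  ⋃ k : ℕ, (fun a : ℝ => ((a - lam k : ℝ) : AddCircle (2 * Real.pi))) ''
    Set.Ioo ((k : ℝ) * T0) (min (((k : ℝ) + 1) * T0) t)

/-- Optimal control time T_opt(T₀). -/
def Topt (T0 : ℝ) : ℝ :=
  sInf { t : ℝ | 0 < t ∧ volume (coveredSet T0 t)ᶜ = 0 }

lemma aux_cover (N : ℕ) (T d : ℝ) (hT : 0 < T) (hNT : (N : ℝ) * T = Real.pi + d)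
    (hd : d ≠ 0) (hdT : 2 * |d| < T) :
    ∃ t : ℝ, 0 < t ∧ coveredSet T t = Set.univ := by
  have hpi := Real.pi_pos
  have hdp : 0 < |d| := abs_pos.mpr hd
  refine ⟨(2 * N * (Real.pi / |d| + 2) + 1) * T, by positivity, ?_⟩
  rw [Set.eq_univ_iff_forall]
  intro x
  obtain ⟨y, hyx, j, hj1, hj2, hj3⟩ : ∃ y : ℝ, (y : AddCircle (2 * Real.pi)) = x ∧
      ∃ j : ℕ, 2 * j * d < y ∧ y < T + 2 * j * d ∧ (j : ℝ) < Real.pi / |d| + 2 := by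
    rcases lt_or_gt_of_ne hd with h | h
    · rw [abs_of_neg h] at *
      have : x ∈ ((↑) : ℝ → AddCircle (2 * Real.pi)) '' Set.Ico (-(2 * Real.pi)) (-(2 * Real.pi) + 2 * Real.pi) := by
        rw [AddCircle.coe_image_Ico_eq]; trivial
      obtain ⟨y, ⟨hy1, hy2⟩, hyx⟩ := this
      refine ⟨y, hyx, ⌊(-y) / (2 * -d)⌋₊ + 1, ?_⟩
      have h0 : 0 ≤ (-y) / (2 * -d) := div_nonneg (by linarith) (by linarith)
      have h1 := Nat.floor_le h0
      have h2 := Nat.lt_floor_add_one ((-y) / (2 * -d))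
      rw [le_div_iff₀ (by linarith)] at h1
      rw [div_lt_iff₀ (by linarith)] at h2
      have h3 : (-y) / (2 * -d) ≤ Real.pi / (-d) := by
        rw [div_le_div_iff₀ (by linarith) (by linarith)]; nlinarith
      have h4 := Nat.floor_le h0
      push_cast
      refine ⟨by linarith, by linarith, by linarith⟩
    · rw [abs_of_pos h] at *
      have : x ∈ ((↑) : ℝ → AddCircle (2 * Real.pi)) '' Set.Ioc 0 (0 + 2 * Real.pi) := by
        rw [AddCircle.coe_image_Ioc_eq]; trivial
      obtain ⟨y, ⟨hy1, hy2⟩, hyx⟩ := this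
      have h0 : 0 < y / (2 * d) := by positivity
      have hc : 0 < ⌈y / (2 * d)⌉₊ := Nat.ceil_pos.mpr h0
      obtain ⟨j, hj⟩ := Nat.exists_eq_succ_of_ne_zero hc.ne'
      have h1 := Nat.le_ceil (y / (2 * d))
      have h2 := Nat.ceil_lt_add_one h0.le
      rw [hj] at h1 h2
      push_cast at h1 h2
      have h2' : (j : ℝ) < y / (2 * d) := by linarith
      have h5 := h2'
      rw [div_le_iff₀ (by linarith)] at h1
      rw [lt_div_iff₀ (by linarith)] at h2'
      have h3 : y / (2 * d) ≤ Real.pi / d := by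
        rw [div_le_div_iff₀ (by linarith) (by linarith)]; nlinarith
      exact ⟨y, hyx, j, by linarith, by linarith, by linarith⟩
  refine Set.mem_iUnion.mpr ⟨2 * N * j, y + j * (2 * Real.pi), ⟨?_, ?_⟩, ?_⟩
  · push_cast
    have : 2 * (N : ℝ) * j * T = 2 * j * (N * T) := by ring
    rw [this, hNT]; linarith
  · have h6 : y + j * (2 * Real.pi) < (2 * (N : ℝ) * j + 1) * T := by
      have : (2 * (N : ℝ) * j + 1) * T = 2 * j * (N * T) + T := by ring
      rw [this, hNT]; linarith
    push_cast
    refine lt_min h6 (h6.trans_le ?_)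
    gcongr
  · have : Even (2 * N * j) := ⟨N * j, by ring⟩
    simp only [lam, this, if_true, sub_zero]
    rw [← hyx]
    refine (QuotientAddGroup.eq.mpr ?_)
    exact AddSubgroup.mem_zmultiples_iff.mpr ⟨-(j : ℤ), by simp⟩

lemma aux_uncovered (n : ℕ) (T d t : ℝ) (hT : 0 < T)
    (hNT : (2 * (n : ℝ) + 1) * T = Real.pi + d) (hdt : (t / T + 1) * |d| ≤ 1 / 2) :
    volume (coveredSet T t)ᶜ ≠ 0 := by
  have hpi := Real.pi_pos
  set V : Set ℝ := {x | Real.sin ((2 * (n : ℝ) + 1) * x) < -(1 / 2)} with hV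
  have hVo : IsOpen V := isOpen_lt (by fun_prop) continuous_const
  set U : Set (AddCircle (2 * Real.pi)) := ((↑) : ℝ → AddCircle (2 * Real.pi)) '' V with hU
  have hUo : IsOpen U := QuotientAddGroup.isOpenMap_coe _ hVo
  have hUn : U.Nonempty := by
    refine ⟨_, -(Real.pi / 2) / (2 * (n : ℝ) + 1), ?_, rfl⟩
    have h : (2 * (n : ℝ) + 1) ≠ 0 := by positivity
    rw [hV, mem_setOf_eq, mul_div_cancel₀ _ h, Real.sin_neg, Real.sin_pi_div_two]
    norm_num
  have hpos : 0 < volume U := hUo.measure_pos _ hUn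
  have hsub : U ⊆ (coveredSet T t)ᶜ := by
    rintro _ ⟨y, hy, rfl⟩ hmem
    obtain ⟨k, a, ⟨ha1, ha2⟩, hay⟩ := Set.mem_iUnion.mp hmem
    have ha3 := ha2.trans_le (min_le_left _ _)
    have ha4 := ha2.trans_le (min_le_right _ _)
    have hk : ((k : ℝ) + 1) * |d| ≤ 1 / 2 := by
      refine le_trans ?_ hdt
      gcongr
      rw [le_div_iff₀ hT]; linarith
    obtain ⟨m, hm⟩ : ∃ m : ℤ, y = a - lam k + m * (2 * Real.pi) := by
      obtain ⟨m, hm⟩ := AddSubgroup.mem_zmultiples_iff.mp (QuotientAddGroup.eq.mp hay)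
      refine ⟨m, ?_⟩
      rw [zsmul_eq_mul] at hm
      linarith
    have hsin : Real.sin ((2 * (n : ℝ) + 1) * y) = Real.sin ((2 * (n : ℝ) + 1) * a - k * Real.pi) := by
      rw [hm]
      rcases Nat.even_or_odd k with hk | hk
      · simp only [lam, hk, if_true]
        obtain ⟨l, rfl⟩ := hk
        rw [← Real.sin_add_int_mul_two_pi ((2 * (n : ℝ) + 1) * a - _) (l + (2 * n + 1) * m)]
        congr 1; push_cast; ring
      · simp only [lam, Nat.not_even_iff_odd.mpr hk, if_false]
        obtain ⟨l, rfl⟩ := hk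
        rw [← Real.sin_add_int_mul_two_pi ((2 * (n : ℝ) + 1) * a - _) (l - n + (2 * n + 1) * m)]
        congr 1; push_cast; ring
    rw [hV, mem_setOf_eq, hsin] at hy
    have hN : 0 < 2 * (n : ℝ) + 1 := by positivity
    have b1 : k * d < (2 * (n : ℝ) + 1) * a - k * Real.pi := by
      have := mul_lt_mul_of_pos_left ha1 hN
      have e : (2 * (n : ℝ) + 1) * (k * T) = k * (Real.pi + d) := by rw [← hNT]; ring
      linarith
    have b2 : (2 * (n : ℝ) + 1) * a - k * Real.pi < Real.pi + (k + 1) * d := by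
      have := mul_lt_mul_of_pos_left ha3 hN
      have e : (2 * (n : ℝ) + 1) * ((k + 1) * T) = (k + 1) * (Real.pi + d) := by rw [← hNT]; ring
      linarith
    have hk0 : (0 : ℝ) ≤ k := Nat.cast_nonneg k
    have c1 : -(1 / 2) ≤ k * d := by
      nlinarith [neg_abs_le d, abs_nonneg d]
    have c2 : (k + 1) * d ≤ 1 / 2 := by
      nlinarith [le_abs_self d, abs_nonneg d]
    set z := (2 * (n : ℝ) + 1) * a - k * Real.pi
    rcases le_total z 0 with hz | hz
    · have := Real.sin_le (x := -z) (by linarith)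
      rw [Real.sin_neg] at this
      linarith
    · rcases le_total z Real.pi with hz' | hz'
      · have := Real.sin_nonneg_of_nonneg_of_le_pi hz hz'
        linarith
      · have := Real.sin_le (x := z - Real.pi) (by linarith)
        rw [Real.sin_sub_pi] at this
        linarith
  exact (hpos.trans_le (measure_mono hsub)).ne'

lemma aux_main (n : ℕ) (T0 : ℝ) (hT0 : T0 = Real.pi / (2 * n + 1)) :
    Filter.Tendsto Topt (𝓝[≠] T0) Filter.atTop := by
  have hN : 0 < 2 * (n : ℝ) + 1 := by positivity
  have hT0p : 0 < T0 := by rw [hT0]; exact div_pos Real.pi_pos hN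
  have hNT0 : (2 * (n : ℝ) + 1) * T0 = Real.pi := by rw [hT0]; field_simp
  rw [Filter.tendsto_atTop]
  intro M
  have e1 : ∀ᶠ T in 𝓝 T0, 0 < T := lt_mem_nhds hT0p
  have e2 : ∀ᶠ T in 𝓝 T0, 2 * |(2 * (n : ℝ) + 1) * (T - T0)| < T := by
    have hc : ContinuousAt (fun T : ℝ => T - 2 * |(2 * (n : ℝ) + 1) * (T - T0)|) T0 := by fun_prop
    have := hc.eventually (lt_mem_nhds (a := 0) (by simpa using hT0p))
    filter_upwards [this] with T h
    linarith
  have e3 : ∀ᶠ T in 𝓝 T0, (M / T + 1) * |(2 * (n : ℝ) + 1) * (T - T0)| < 1 / 2 := by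
    have hc : ContinuousAt (fun T : ℝ => (M / T + 1) * |(2 * (n : ℝ) + 1) * (T - T0)|) T0 := by
      have : ContinuousAt (fun T : ℝ => M / T) T0 := continuousAt_const.div continuousAt_id hT0p.ne'
      fun_prop
    exact hc.eventually_lt continuousAt_const (by simp)
  filter_upwards [nhdsWithin_le_nhds e1, nhdsWithin_le_nhds e2, nhdsWithin_le_nhds e3,
    self_mem_nhdsWithin] with T h1 h2 h3 h4
  have h4' : T - T0 ≠ 0 := sub_ne_zero.mpr h4
  have hNT : (2 * (n : ℝ) + 1) * T = Real.pi + (2 * (n : ℝ) + 1) * (T - T0) := by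
    rw [← hNT0]; ring
  refine le_csInf ?_ ?_
  · obtain ⟨t, ht, hc⟩ := aux_cover (2 * n + 1) T _ h1 (by push_cast; exact hNT)
      (mul_ne_zero hN.ne' h4') h2
    exact ⟨t, ht, by rw [hc]; simp⟩
  · rintro t ⟨ht, hc⟩
    by_contra! hlt
    refine aux_uncovered n T _ t h1 hNT ?_ hc
    refine le_trans ?_ h3.le
    gcongr

/-- Proposition 4.3: at T₀ = π/(2n+1) both one-sided limits of T_opt, taken
through points of (0,2π) \ {π/(2m+1) : m ∈ ℕ} where T_opt is defined, are +∞. -/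
theorem stmt_17 (n : ℕ) (T0 : ℝ) (hT0 : T0 = Real.pi / (2 * n + 1)) :
    Filter.Tendsto Topt
      (nhdsWithin T0 ((Set.Ioo 0 (2 * Real.pi) \
        { x : ℝ | ∃ m : ℕ, x = Real.pi / (2 * m + 1) }) ∩ Set.Iio T0))
      Filter.atTop ∧
    Filter.Tendsto Topt
      (nhdsWithin T0 ((Set.Ioo 0 (2 * Real.pi) \
        { x : ℝ | ∃ m : ℕ, x = Real.pi / (2 * m + 1) }) ∩ Set.Ioi T0))
      Filter.atTop := by
  have h := aux_main n T0 hT0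
  exact ⟨h.mono_left (nhdsWithin_mono _ fun x hx => ne_of_lt hx.2),
    h.mono_left (nhdsWithin_mono _ fun x hx => ne_of_gt hx.2)⟩
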